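/- Let G ≤ GL(2, q) with q = p prime, containing the scalar group Z, acting irreducibly and primitively, and suppose G has exactly q+1 Sylow p-subgroups. Then G contains SL(2, q). -/

import Mathlib

open Matrix

namespace Matrix

/-- A nonzero nilpotent `2 × 2` matrix over a field has rank one, with image and kernel both
spanned by the vector `(a, b)`. -/
theorem exists_eq_smul_of_isNilpotent {F : Type*} [Field F] {N : Matrix (Fin 2) (Fin 2) F}
    (hN : IsNilpotent N) (h0 : N ≠ 0) :
    ∃ a b k : F, k ≠ 0 ∧ N = !![k * (a * b), -(k * a ^ 2); k * b ^ 2, -(k * (a * b))] := by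
  have ht : N 0 0 + N 1 1 = 0 := by
    rw [← trace_fin_two]
    exact (isNilpotent_trace_of_isNilpotent hN).eq_zero
  have hd : N 0 0 * N 1 1 - N 0 1 * N 1 0 = 0 := by
    rw [← det_fin_two]
    obtain ⟨n, hn⟩ := hN
    refine IsNilpotent.eq_zero ⟨n + 1, ?_⟩
    rw [← det_pow, pow_succ, hn, zero_mul, det_zero]
  have h11 : N 1 1 = -N 0 0 := by linear_combination ht
  rw [h11] at hd
  by_cases hy : N 0 1 = 0
  · have hx : N 0 0 = 0 := by simpa [hy] using hd
    refine ⟨0, 1, N 1 0, ?_, ?_⟩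
    · intro hz
      apply h0
      ext i j
      fin_cases i <;> fin_cases j <;> simp [hx, hy, hz, h11]
    · ext i j
      fin_cases i <;> fin_cases j <;> simp [hx, hy, h11]
  · refine ⟨1, -(N 0 0 / N 0 1), -N 0 1, neg_ne_zero.2 hy, ?_⟩
    ext i j
    fin_cases i <;> fin_cases j <;> simp [h11] <;> field_simp
    linear_combination -hd

/-- Two nonzero nilpotent `2 × 2` matrices over a field are either proportional or simultaneously
conjugate to a strictly upper and a strictly lower triangular matrix. -/
theorem exists_conj_of_isNilpotent {F : Type*} [Field F] {N M : Matrix (Fin 2) (Fin 2) F}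
    (hN : IsNilpotent N) (hN0 : N ≠ 0) (hM : IsNilpotent M) (hM0 : M ≠ 0)
    (h : ∀ c : F, M ≠ c • N) :
    ∃ (S : GL (Fin 2) F) (α β : F), α ≠ 0 ∧ β ≠ 0 ∧
      N * S = S * !![0, α; 0, 0] ∧ M * S = S * !![0, 0; β, 0] := by
  obtain ⟨a, b, k, hk, rfl⟩ := exists_eq_smul_of_isNilpotent hN hN0
  obtain ⟨c, d, l, hl, rfl⟩ := exists_eq_smul_of_isNilpotent hM hM0
  have hD : a * d - b * c ≠ 0 := by
    intro hD
    by_cases ha : a = 0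
    · have hb : b ≠ 0 := by
        rintro rfl
        apply hN0
        ext i j
        fin_cases i <;> fin_cases j <;> simp [ha]
      have hc : c = 0 := by simpa [ha, hb] using hD
      refine h (l * d ^ 2 / (k * b ^ 2)) ?_
      ext i j
      fin_cases i <;> fin_cases j <;> simp [ha, hc]
      field_simp
    · have hd : d = b * c / a := by
        field_simp
        linear_combination hD
      refine h (l * c ^ 2 / (k * a ^ 2)) ?_
      ext i j
      fin_cases i <;> fin_cases j <;> simp [hd] <;> field_simp
  refine ⟨GeneralLinearGroup.mkOfDetNeZero !![a, c; b, d] ?_, -(k * (a * d - b * c)),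
    l * (a * d - b * c), neg_ne_zero.2 (mul_ne_zero hk hD), mul_ne_zero hl hD, ?_, ?_⟩
  · rw [det_fin_two_of]
    contrapose hD
    linear_combination hD
  all_goals
    ext i j
    fin_cases i <;> fin_cases j <;>
      simp [GeneralLinearGroup.mkOfDetNeZero, Matrix.mul_apply, Fin.sum_univ_two] <;> ring

/-- An element of `p`-power order in `GL(2, p)` is unipotent. -/
theorem GeneralLinearGroup.isNilpotent_sub_one {p : ℕ} [Fact p.Prime]
    {g : GL (Fin 2) (ZMod p)} {n : ℕ} (hg : g ^ p ^ n = 1) :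
    IsNilpotent ((g : Matrix (Fin 2) (Fin 2) (ZMod p)) - 1) := by
  refine ⟨p ^ n, ?_⟩
  rw [sub_pow_char_pow_of_commute p n (Commute.one_right _), ← Units.val_pow_eq_pow_val, hg]
  simp

/-- A nilpotent `2 × 2` matrix over a field has square zero. -/
theorem sq_eq_zero_of_isNilpotent {F : Type*} [Field F] {N : Matrix (Fin 2) (Fin 2) F}
    (hN : IsNilpotent N) : N * N = 0 := by
  by_cases h0 : N = 0
  · simp [h0]
  obtain ⟨a, b, k, -, rfl⟩ := exists_eq_smul_of_isNilpotent hN h0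
  ext i j
  fin_cases i <;> fin_cases j <;> simp [Matrix.mul_apply, Fin.sum_univ_two] <;> ring

/-- The powers of a unipotent element `g` of `GL(2, p)` are the matrices `1 + c (g - 1)`. -/
theorem GeneralLinearGroup.coe_pow_val_of_isNilpotent {p : ℕ} [Fact p.Prime] {g : GL (Fin 2) (ZMod p)}
    (hg : IsNilpotent ((g : Matrix (Fin 2) (Fin 2) (ZMod p)) - 1)) (c : ZMod p) :
    ((g ^ c.val : GL (Fin 2) (ZMod p)) : Matrix (Fin 2) (Fin 2) (ZMod p)) =
      1 + c • ((g : Matrix (Fin 2) (Fin 2) (ZMod p)) - 1) := by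
  have key : ∀ n : ℕ, (g : Matrix (Fin 2) (Fin 2) (ZMod p)) ^ n =
      1 + (n : ZMod p) • ((g : Matrix (Fin 2) (Fin 2) (ZMod p)) - 1) := by
    intro n
    induction n with
    | zero => simp
    | succ n ih =>
      have hs : (g : Matrix (Fin 2) (Fin 2) (ZMod p)) = 1 + (g - 1) := by abel
      rw [pow_succ, ih]
      nth_rewrite 2 [hs]
      rw [mul_add, add_mul _ _ ((g : Matrix (Fin 2) (Fin 2) (ZMod p)) - 1), mul_one,
        smul_mul_assoc, sq_eq_zero_of_isNilpotent hg]
      push_cast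
      simp only [one_mul, smul_zero, add_smul, one_smul, add_zero]
      abel
  rw [Units.val_pow_eq_pow_val, key, ZMod.natCast_zmod_val]

/-- A subgroup of `GL(2, p)` containing a nontrivial unipotent element and another unipotent
element that is not a power of it contains `SL(2, p)`. -/
theorem GeneralLinearGroup.toGL_mem_of_isNilpotent {p : ℕ} [Fact p.Prime]
    {G : Subgroup (GL (Fin 2) (ZMod p))} {g h : GL (Fin 2) (ZMod p)} (hg : g ∈ G) (hh : h ∈ G)
    (hgn : IsNilpotent ((g : Matrix (Fin 2) (Fin 2) (ZMod p)) - 1))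
    (hhn : IsNilpotent ((h : Matrix (Fin 2) (Fin 2) (ZMod p)) - 1))
    (hg1 : g ≠ 1) (hne : ∀ n : ℕ, h ≠ g ^ n) (A : SpecialLinearGroup (Fin 2) (ZMod p)) :
    SpecialLinearGroup.toGL A ∈ G := by
  obtain ⟨S, α, β, hα, hβ, hS, hS'⟩ := exists_conj_of_isNilpotent hgn
    (sub_ne_zero.2 fun e ↦ hg1 (Units.ext e)) hhn
    (sub_ne_zero.2 fun e ↦ hne 0 (Units.ext (by simpa using e)))
    (fun c e ↦ hne c.val (Units.ext (by rw [coe_pow_val_of_isNilpotent hgn, ← e]; abel)))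
  let φ := (MulAut.conj S).toMonoidHom.comp (SpecialLinearGroup.toGL (n := Fin 2) (R := ZMod p))
  have hK : ∀ B, B ∈ G.comap φ := by
    refine SL2.transvection_induction _ (fun i j hij x ↦ ?_) fun _ _ ↦ mul_mem
    rw [Subgroup.mem_comap]
    obtain ⟨rfl, rfl⟩ | ⟨rfl, rfl⟩ : i = 0 ∧ j = 1 ∨ i = 1 ∧ j = 0 := by omega
    · convert G.pow_mem hg (x / α).val using 1
      refine mul_inv_eq_of_eq_mul (Units.ext ?_)
      rw [Units.val_mul, Units.val_mul, coe_pow_val_of_isNilpotent hgn, add_mul,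
        smul_mul_assoc, hS, ← mul_smul_comm, one_mul, ← mul_one_add]
      congr 1
      ext i j
      fin_cases i <;> fin_cases j <;> simp [SpecialLinearGroup.transvection_coe, hα]
    · convert G.pow_mem hh (x / β).val using 1
      refine mul_inv_eq_of_eq_mul (Units.ext ?_)
      rw [Units.val_mul, Units.val_mul, coe_pow_val_of_isNilpotent hhn, add_mul,
        smul_mul_assoc, hS', ← mul_smul_comm, one_mul, ← mul_one_add]
      congr 1
      ext i j
      fin_cases i <;> fin_cases j <;> simp [SpecialLinearGroup.transvection_coe, hβ]
  obtain ⟨B, hB⟩ : ∃ B, φ B = SpecialLinearGroup.toGL A := by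
    have hd : (((S⁻¹ * SpecialLinearGroup.toGL A * S : GL (Fin 2) (ZMod p))) :
        Matrix (Fin 2) (Fin 2) (ZMod p)).det = 1 := by
      rw [Units.val_mul, det_mul_comm, ← Units.val_mul, mul_inv_cancel_left]
      exact A.2
    refine ⟨⟨_, hd⟩, mul_inv_eq_of_eq_mul ?_⟩
    have e : SpecialLinearGroup.toGL ⟨_, hd⟩ = S⁻¹ * SpecialLinearGroup.toGL A * S :=
      Units.ext rfl
    rw [e]
    group
  rw [← hB]
  exact hK B

end Matrix

/-- Let `G ≤ GL(2,p)` (`p` prime) contain the scalars, act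
irreducibly and primitively on `F_p²`, and have exactly `p + 1` Sylow
`p`-subgroups. Then `SL(2,p) ≤ G`. -/
theorem stmt_15 (p : ℕ) [Fact p.Prime]
    (G : Subgroup (GL (Fin 2) (ZMod p)))
    (hZ : ∀ c : (ZMod p)ˣ, ∃ g ∈ G,
      ((g : GL (Fin 2) (ZMod p)) : Matrix (Fin 2) (Fin 2) (ZMod p)) =
        (c : ZMod p) • (1 : Matrix (Fin 2) (Fin 2) (ZMod p)))
    (hirr : ∀ W : Submodule (ZMod p) (Fin 2 → ZMod p),
      (∀ g ∈ G, ∀ v ∈ W,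
        Matrix.mulVec ((g : GL (Fin 2) (ZMod p)) : Matrix (Fin 2) (Fin 2) (ZMod p)) v ∈ W) →
      W = ⊥ ∨ W = ⊤)
    (hprim : ¬ ∃ W₁ W₂ : Submodule (ZMod p) (Fin 2 → ZMod p),
      W₁ ≠ W₂ ∧ W₁ ≠ ⊥ ∧ W₂ ≠ ⊥ ∧ W₁ ⊔ W₂ = ⊤ ∧ W₁ ⊓ W₂ = ⊥ ∧
      ∀ g ∈ G,
        ((∀ v ∈ W₁, Matrix.mulVec ((g : GL (Fin 2) (ZMod p)) : Matrix (Fin 2) (Fin 2) (ZMod p)) v ∈ W₁) ∧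
          (∀ v ∈ W₂, Matrix.mulVec ((g : GL (Fin 2) (ZMod p)) : Matrix (Fin 2) (Fin 2) (ZMod p)) v ∈ W₂)) ∨
        ((∀ v ∈ W₁, Matrix.mulVec ((g : GL (Fin 2) (ZMod p)) : Matrix (Fin 2) (Fin 2) (ZMod p)) v ∈ W₂) ∧
          (∀ v ∈ W₂, Matrix.mulVec ((g : GL (Fin 2) (ZMod p)) : Matrix (Fin 2) (Fin 2) (ZMod p)) v ∈ W₁)))
    (hsyl : Nat.card (Sylow p G) = p + 1) :
    ∀ A : Matrix.SpecialLinearGroup (Fin 2) (ZMod p),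
      Matrix.SpecialLinearGroup.toGL A ∈ G := by
  obtain ⟨P, Q, hPQ⟩ : ∃ P Q : Sylow p G, P ≠ Q := by
    have : Finite (Sylow p G) := Nat.finite_of_card_ne_zero (by omega)
    have : Nontrivial (Sylow p G) :=
      Finite.one_lt_card_iff_nontrivial.1 (by have := (Fact.out : p.Prime).pos; omega)
    exact exists_pair_ne _
  obtain ⟨a, haP, haQ⟩ := SetLike.not_le_iff_exists.1
    fun h : (P : Subgroup G) ≤ Q ↦ hPQ (Sylow.ext (P.is_maximal' Q.2 h).symm)
  obtain ⟨b, hbQ, hbP⟩ := SetLike.not_le_iff_exists.1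
    fun h : (Q : Subgroup G) ≤ P ↦ hPQ (Sylow.ext (Q.is_maximal' P.2 h))
  obtain ⟨m, hm⟩ := P.2 ⟨a, haP⟩
  obtain ⟨n, hn⟩ := Q.2 ⟨b, hbQ⟩
  refine GeneralLinearGroup.toGL_mem_of_isNilpotent a.2 b.2
    (GeneralLinearGroup.isNilpotent_sub_one (n := m) ?_)
    (GeneralLinearGroup.isNilpotent_sub_one (n := n) ?_) ?_ ?_
  · simpa [Subtype.ext_iff] using hm
  · simpa [Subtype.ext_iff] using hn
  · intro h
    exact haQ (by rw [show a = 1 from Subtype.ext h]; exact one_mem _)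
  · intro k h
    exact hbP (by rw [show b = a ^ k from Subtype.ext h]; exact pow_mem haP k)
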